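/- Let Σ ∈ ℝ^{d×d} be a symmetric positive semidefinite matrix whose largest eigenvalue λ₁ has multiplicity one, let v* be a corresponding unit eigenvector, and let λ₂ be its second largest eigenvalue. Then for every unit vector u ∈ ℝ^d, (1/2)(λ₁ − λ₂) ‖v* v*ᵀ − u uᵀ‖_F² ≤ tr( Σ (v* v*ᵀ − u uᵀ) ). -/

import Mathlib

open MeasureTheory ProbabilityTheory Matrix Finset

noncomputable section

namespace StructuredPCA

/-- Euclidean inner product on `Fin d → ℝ`. -/
def ip {d : ℕ} (u v : Fin d → ℝ) : ℝ := ∑ i, u i * v i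

/-- Euclidean norm on `Fin d → ℝ`. -/
def nrm {d : ℕ} (v : Fin d → ℝ) : ℝ := Real.sqrt (∑ i, v i ^ 2)

/-- Quadratic form `vᵀ A v`. -/
def quad {d : ℕ} (A : Matrix (Fin d) (Fin d) ℝ) (v : Fin d → ℝ) : ℝ := ip v (A.mulVec v)

/-- `ρ(A, S) = sup { |vᵀ A v| : v ∈ S, ‖v‖ = 1 }`. -/
def rho {d : ℕ} (A : Matrix (Fin d) (Fin d) ℝ) (S : Set (Fin d → ℝ)) : ℝ :=
  sSup {x : ℝ | ∃ v ∈ S, nrm v = 1 ∧ x = |quad A v|}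

/-- Frobenius norm of a matrix. -/
def frob {d : ℕ} (A : Matrix (Fin d) (Fin d) ℝ) : ℝ :=
  Real.sqrt (∑ i, ∑ j, A i j ^ 2)

/-- Operator (spectral) norm of a matrix. -/
def opNorm {d : ℕ} (A : Matrix (Fin d) (Fin d) ℝ) : ℝ :=
  sSup {x : ℝ | ∃ v, nrm v = 1 ∧ x = nrm (A.mulVec v)}

/-- The spiked covariance `λ v* v*ᵀ + I`. -/
def spikedCov {d : ℕ} (lam : ℝ) (vstar : Fin d → ℝ) : Matrix (Fin d) (Fin d) ℝ :=
  lam • vecMulVec vstar vstar + 1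

/-- `x 1, …, x n` are spiked Wishart samples with spike `v*`:
`x i = √λ g i • v* + z i` with `g, z` i.i.d. standard normal, mutually independent. -/
def IsSpikedWishart {d n : ℕ} {Ω : Type*} [MeasurableSpace Ω] (μ : Measure Ω)
    (lam : ℝ) (vstar : Fin d → ℝ) (x : Fin n → Ω → Fin d → ℝ) : Prop :=
  ∃ G : (Fin n ⊕ Fin n × Fin d) → Ω → ℝ,
    (∀ i, Measurable (G i)) ∧
    iIndepFun G μ ∧
    (∀ i, μ.map (G i) = gaussianReal 0 1) ∧
    ∀ i ω j, x i ω j = Real.sqrt lam * G (Sum.inl i) ω * vstar j + G (Sum.inr (i, j)) ω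

/-- The sample covariance matrix `n⁻¹ ∑ xᵢ xᵢᵀ`. -/
def sampleCov {d n : ℕ} {Ω : Type*} (x : Fin n → Ω → Fin d → ℝ) (ω : Ω) :
    Matrix (Fin d) (Fin d) ℝ :=
  (n : ℝ)⁻¹ • ∑ i, vecMulVec (x i ω) (x i ω)

/-- Union-of-linear-structures data: an orthonormal basis `φ` and subsets `Bs m`. -/
structure UnionStruct (d M : ℕ) where
  φ : Fin d → Fin d → ℝ
  orthonormal : ∀ i j, ip (φ i) (φ j) = if i = j then 1 else 0
  Bs : Fin M → Finset (Fin d)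

/-- The subspace `L m = span (B m)`. -/
def UnionStruct.L {d M : ℕ} (U : UnionStruct d M) (m : Fin M) : Submodule ℝ (Fin d → ℝ) :=
  Submodule.span ℝ (U.φ '' (U.Bs m : Set (Fin d)))

/-- The union `𝓜 = ⋃ m, L m`. -/
def UnionStruct.carrier {d M : ℕ} (U : UnionStruct d M) : Set (Fin d → ℝ) :=
  ⋃ m, (U.L m : Set (Fin d → ℝ))

/-- A `(d,k)`-layered graph. -/
structure LayeredGraph (d k : ℕ) where
  vs : Fin d
  vt : Fin d
  hst : vs ≠ vt
  V : Fin k → Finset (Fin d)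
  hvs : ∀ j, vs ∉ V j
  hvt : ∀ j, vt ∉ V j
  hdisj : ∀ j j', j ≠ j' → Disjoint (V j) (V j')
  hdvd : k ∣ (d - 2)
  hcard : ∀ j, (V j).card = (d - 2) / k
  hcover : ∀ i, i ≠ vs → i ≠ vt → ∃ j, i ∈ V j

/-- A member of `P^k`: contains `v_s`, `v_t` and exactly one vertex of each layer. -/
def LayeredGraph.IsPathSet {d k : ℕ} (G : LayeredGraph d k) (P : Finset (Fin d)) : Prop :=
  G.vs ∈ P ∧ G.vt ∈ P ∧ ∀ j, (P ∩ G.V j).card = 1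

/-- `v` is `k`-path-sparse. -/
def LayeredGraph.PathSparse {d k : ℕ} (G : LayeredGraph d k) (v : Fin d → ℝ) : Prop :=
  ∃ P, G.IsPathSet P ∧ ∀ i, v i ≠ 0 → i ∈ P

/-- A member of `T^k`: a `k`-element rooted connected subtree of the complete binary
tree on nodes `1, …, d` (node `i ≥ 2` has parent `i / 2`). -/
def IsTreeSet (d k : ℕ) (T : Finset ℕ) : Prop :=
  T.card = k ∧ 1 ∈ T ∧ (∀ i ∈ T, 1 ≤ i ∧ i ≤ d) ∧ ∀ i ∈ T, 2 ≤ i → i / 2 ∈ T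

/-- `v` is `k`-tree-sparse (coordinate `i : Fin d` corresponds to node `i + 1`). -/
def TreeSparse (d k : ℕ) (v : Fin d → ℝ) : Prop :=
  ∃ T, IsTreeSet d k T ∧ ∀ i : Fin d, v i ≠ 0 → (i : ℕ) + 1 ∈ T

/-- The index of the parent node: coordinate `i` is node `i+1`, whose parent is `(i+1)/2`. -/
def parentIdx {d : ℕ} (i : Fin d) : Fin d :=
  ⟨((i : ℕ) + 1) / 2 - 1, by have := i.isLt; omega⟩

/-- The feasible set of the SDP relaxation for tree-sparse PCA. -/
def sdpFeasible (d k : ℕ) : Set (Matrix (Fin d) (Fin d) ℝ) :=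
  {Mm | Mm.PosSemidef ∧ (∑ i, Mm i i) = 1 ∧ (∑ i, ∑ j, |Mm i j|) ≤ (k : ℝ) ∧
    ∀ i : Fin d, 2 ≤ (i : ℕ) + 1 → Mm i i ≤ Mm (parentIdx i) (parentIdx i)}


theorem ip_eq_dot {d : ℕ} (u v : Fin d → ℝ) : ip u v = u ⬝ᵥ v := rfl

theorem nrm_one {d : ℕ} {u : Fin d → ℝ} : nrm u = 1 ↔ u ⬝ᵥ u = 1 := by
  unfold nrm dotProduct
  rw [Real.sqrt_eq_one]
  simp only [sq]

theorem frob_sq {d : ℕ} (v u : Fin d → ℝ) :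
    frob (vecMulVec v v - vecMulVec u u) ^ 2
      = (v ⬝ᵥ v) ^ 2 - 2 * (u ⬝ᵥ v) ^ 2 + (u ⬝ᵥ u) ^ 2 := by
  unfold frob
  rw [Real.sq_sqrt (by positivity)]
  simp only [dotProduct, sq, Finset.sum_mul_sum]
  simp only [Finset.mul_sum, ← Finset.sum_sub_distrib,
    ← Finset.sum_add_distrib]
  refine Finset.sum_congr rfl fun i _ => Finset.sum_congr rfl fun j _ => ?_
  simp only [Matrix.sub_apply, vecMulVec_apply]
  ring

theorem trace_quad {d : ℕ} (A : Matrix (Fin d) (Fin d) ℝ) (v : Fin d → ℝ) :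
    Matrix.trace (A * vecMulVec v v) = v ⬝ᵥ A *ᵥ v := by
  rw [Matrix.mul_vecMulVec, Matrix.trace_vecMulVec, dotProduct_comm]

/-- curvature lemma: for a symmetric PSD matrix `Σ` whose largest
eigenvalue `λ₁` is simple with unit eigenvector `v*` and second eigenvalue `λ₂`,
`(1/2)(λ₁ − λ₂)‖v*v*ᵀ − uuᵀ‖_F² ≤ tr(Σ(v*v*ᵀ − uuᵀ))` for every unit vector `u`. -/
theorem curvature_of_matrix
    {d : ℕ} (Sig : Matrix (Fin d) (Fin d) ℝ) (hpsd : Sig.PosSemidef)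
    (lam1 lam2 : ℝ) (vstar : Fin d → ℝ)
    (heig : Sig.mulVec vstar = lam1 • vstar) (hvstar_nrm : nrm vstar = 1)
    (htop : ∀ u : Fin d → ℝ, nrm u = 1 → quad Sig u ≤ lam1)
    (hsecond : ∀ u : Fin d → ℝ, nrm u = 1 → ip u vstar = 0 → quad Sig u ≤ lam2)
    (hsimple : lam2 < lam1)
    (u : Fin d → ℝ) (hu : nrm u = 1) :
    (1 / 2) * (lam1 - lam2) * frob (vecMulVec vstar vstar - vecMulVec u u) ^ 2 ≤
      Matrix.trace (Sig * (vecMulVec vstar vstar - vecMulVec u u)) := by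
  rw [nrm_one] at hvstar_nrm hu
  rw [frob_sq, Matrix.mul_sub, Matrix.trace_sub, trace_quad, trace_quad, hvstar_nrm, hu, heig,
    dotProduct_smul, hvstar_nrm]
  obtain ⟨c, hc⟩ : ∃ c, c = u ⬝ᵥ vstar := ⟨_, rfl⟩
  obtain ⟨w, hw⟩ : ∃ w, w = u - c • vstar := ⟨_, rfl⟩
  have hwv : w ⬝ᵥ vstar = 0 := by
    rw [hw, sub_dotProduct, smul_dotProduct, hvstar_nrm, ← hc]; simp
  have hu' : u = w + c • vstar := by rw [hw]; simp
  have hvw : vstar ⬝ᵥ w = 0 := by rw [dotProduct_comm, hwv]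
  have hww : w ⬝ᵥ w = 1 - c ^ 2 := by
    have h := hu
    rw [hu'] at h
    simp only [add_dotProduct, dotProduct_add, smul_dotProduct, dotProduct_smul, hwv, hvw,
      hvstar_nrm, smul_eq_mul] at h
    linarith
  have hvSw : vstar ⬝ᵥ Sig *ᵥ w = 0 := by
    have hT : Sigᵀ = Sig := by simpa using hpsd.isHermitian.eq
    rw [dotProduct_mulVec, ← mulVec_transpose, hT, heig, smul_dotProduct, hvw, smul_zero]
  have hq : u ⬝ᵥ Sig *ᵥ u = w ⬝ᵥ Sig *ᵥ w + c ^ 2 * lam1 := by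
    rw [hu']
    simp only [mulVec_add, mulVec_smul, heig, add_dotProduct, dotProduct_add, smul_dotProduct,
      dotProduct_smul, hwv, hvSw, hvstar_nrm, smul_eq_mul]
    ring
  have hbound : w ⬝ᵥ Sig *ᵥ w ≤ lam2 * (w ⬝ᵥ w) := by
    by_cases h0 : w = 0
    · simp [h0]
    have hpos : 0 < w ⬝ᵥ w := by
      have h1 : 0 ≤ w ⬝ᵥ w := Finset.sum_nonneg fun i _ => mul_self_nonneg _
      exact lt_of_le_of_ne h1 fun h => h0 (dotProduct_self_eq_zero.1 h.symm)
    obtain ⟨r, hr⟩ : ∃ r, r = Real.sqrt (w ⬝ᵥ w) := ⟨_, rfl⟩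
    have hr2 : r * r = w ⬝ᵥ w := by rw [hr, Real.mul_self_sqrt hpos.le]
    have hr0 : r ≠ 0 := by rw [hr]; exact (Real.sqrt_pos.2 hpos).ne'
    have h := hsecond (r⁻¹ • w) (by
      rw [nrm_one, smul_dotProduct, dotProduct_smul, ← hr2]
      simp only [smul_eq_mul]
      field_simp) (by rw [ip_eq_dot, smul_dotProduct, hwv, smul_zero])
    rw [quad, ip_eq_dot, mulVec_smul, smul_dotProduct, dotProduct_smul] at h
    simp only [smul_eq_mul] at h
    have h2 := mul_le_mul_of_nonneg_left h (mul_self_nonneg r)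
    have h3 : r * r * (r⁻¹ * (r⁻¹ * (w ⬝ᵥ Sig *ᵥ w))) = w ⬝ᵥ Sig *ᵥ w := by
      field_simp
    rw [h3, hr2] at h2
    linarith
  rw [hq, ← hc, smul_eq_mul]
  rw [hww] at hbound
  nlinarith

end StructuredPCA
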